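/- There exist two distinct positive Borel measures μ, ν on (0,∞), both with all integer moments equal to γₙ = exp((n+1)²/(4k²)) for a fixed k > 0, such that ν has a density with respect to Lebesgue measure that is continuous but nowhere differentiable on (0,∞), while μ has a smooth density. -/

import Mathlib

open Real MeasureTheory Set

noncomputable def tent (x : ℝ) : ℝ := |x - round x|

lemma tent_cont : Continuous tent := by
  have : tent = fun x : ℝ => ‖(x : UnitAddCircle)‖ := by
    ext x; rw [UnitAddCircle.norm_eq]; rfl
  rw [this]
  exact continuous_norm.comp (AddCircle.continuous_mk' 1)

lemma tent_nonneg (x : ℝ) : 0 ≤ tent x := abs_nonneg _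
lemma tent_le (x : ℝ) : tent x ≤ 1 / 2 := abs_sub_round x

lemma tent_add_int (x : ℝ) (m : ℤ) : tent (x + m) = tent x := by
  unfold tent; rw [round_add_intCast]; push_cast; congr 1; ring

lemma tent_int (m : ℤ) : tent m = 0 := by simp [tent]

lemma tent_left (x : ℝ) (j : ℤ) (h1 : (j : ℝ) ≤ x) (h2 : x ≤ j + 1 / 2) : tent x = x - j := by
  unfold tent
  have hf : ⌊x⌋ = j := by rw [Int.floor_eq_iff]; constructor <;> linarith
  rw [abs_sub_round_eq_min, Int.fract, hf, min_eq_left (by linarith)]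

lemma tent_right (x : ℝ) (j : ℤ) (h1 : (j : ℝ) + 1 / 2 ≤ x) (h2 : x ≤ j + 1) :
    tent x = j + 1 - x := by
  rcases h2.eq_or_lt with h | h
  · rw [h]; have := tent_int (j + 1); push_cast at this; rw [this]; ring
  unfold tent
  have hf : ⌊x⌋ = j := by rw [Int.floor_eq_iff]; constructor <;> linarith
  rw [abs_sub_round_eq_min, Int.fract, hf, min_eq_right (by linarith)]; ring

lemma tent_affine (a b : ℝ) (i : ℤ) (ha : (i : ℝ) / 2 ≤ a) (hab : a ≤ b) (hb : b ≤ (i + 1) / 2) :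
    tent ((a + b) / 2) = (tent a + tent b) / 2 := by
  rcases Int.even_or_odd' i with ⟨j, rfl | rfl⟩
  · push_cast at ha hb
    rw [tent_left a j, tent_left b j, tent_left _ j] <;> linarith
  · push_cast at ha hb
    rw [tent_right a j, tent_right b j, tent_right _ j] <;> linarith

noncomputable def tak (x : ℝ) : ℝ := ∑' n : ℕ, (1 / 2 : ℝ) ^ n * tent (2 ^ n * x)

lemma tak_bound (x : ℝ) (n : ℕ) : ‖(1 / 2 : ℝ) ^ n * tent (2 ^ n * x)‖ ≤ (1 / 2 : ℝ) ^ n := by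
  rw [norm_mul, Real.norm_of_nonneg (by positivity), Real.norm_of_nonneg (tent_nonneg _)]
  have := tent_le (2 ^ n * x)
  exact mul_le_of_le_one_right (by positivity) (by linarith)

lemma tak_summable (x : ℝ) : Summable fun n : ℕ => (1 / 2 : ℝ) ^ n * tent (2 ^ n * x) :=
  Summable.of_norm_bounded summable_geometric_two (tak_bound x)

lemma tak_cont : Continuous tak := by
  unfold tak
  refine continuous_tsum (fun n => ?_) summable_geometric_two (fun n x => tak_bound x n)
  exact continuous_const.mul (tent_cont.comp (by fun_prop))

lemma tak_nonneg (x : ℝ) : 0 ≤ tak x :=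
  tsum_nonneg fun n => mul_nonneg (by positivity) (tent_nonneg _)

lemma tak_le (x : ℝ) : tak x ≤ 2 := by
  rw [← tsum_geometric_two]
  exact (tak_summable x).tsum_le_tsum (fun n => (le_abs_self _).trans (tak_bound x n))
    summable_geometric_two

lemma tak_add_int (x : ℝ) (m : ℤ) : tak (x + m) = tak x := by
  unfold tak
  congr 1; ext n
  have := tent_add_int (2 ^ n * x) (2 ^ n * m)
  push_cast at this
  rw [mul_add, this]

lemma tak_fe (x : ℝ) : tak x = tent x + tak (2 * x) / 2 := by
  unfold tak
  rw [(tak_summable x).tsum_eq_zero_add, ← tsum_div_const]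
  congr 1
  · simp
  · congr 1; ext n
    rw [pow_succ, pow_succ, mul_assoc (2 ^ n) 2 x]; ring

lemma tak_int (m : ℤ) : tak m = 0 := by
  have h := tak_add_int 0 m
  have h0 := tak_fe 0
  have ht := tent_int 0
  simp only [Int.cast_zero, mul_zero, zero_add] at *
  linarith

lemma tak_defect (n : ℕ) (m : ℤ) :
    tak ((m / 2 ^ n + (m + 1) / 2 ^ n) / 2) - (tak (m / 2 ^ n) + tak ((m + 1) / 2 ^ n)) / 2
      = 1 / 2 ^ (n + 1) := by
  induction n with
  | zero =>
    have h1 := tak_int m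
    have h2 := tak_int (m + 1)
    have h3 := tak_int (2 * m + 1)
    push_cast at h2 h3
    simp only [pow_zero, div_one, h1, h2]
    rw [tak_fe, tent_left _ m (by linarith) (by linarith)]
    rw [show 2 * (((m : ℝ) + (m + 1)) / 2) = 2 * m + 1 by ring, h3]
    ring
  | succ n ih =>
    have e1 : 2 * ((m : ℝ) / 2 ^ (n + 1)) = m / 2 ^ n := by field_simp; ring
    have e2 : 2 * (((m : ℝ) + 1) / 2 ^ (n + 1)) = (m + 1) / 2 ^ n := by field_simp; ring
    have e3 : 2 * (((m : ℝ) / 2 ^ (n + 1) + (m + 1) / 2 ^ (n + 1)) / 2)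
      = (m / 2 ^ n + (m + 1) / 2 ^ n) / 2 := by rw [← e1, ← e2]; ring
    have hpos : (0 : ℤ) < 2 ^ n := by positivity
    have i1 : (m / 2 ^ n) * 2 ^ n ≤ m := Int.ediv_mul_le _ hpos.ne'
    have i2 : m + 1 ≤ (m / 2 ^ n + 1) * 2 ^ n := Int.lt_ediv_add_one_mul_self m hpos
    have r1 : ((m / 2 ^ n : ℤ) : ℝ) * 2 ^ n ≤ m := by exact_mod_cast i1
    have r2 : (m : ℝ) + 1 ≤ (((m / 2 ^ n : ℤ) : ℝ) + 1) * 2 ^ n := by exact_mod_cast i2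
    have ha := tent_affine (m / 2 ^ (n + 1)) ((m + 1) / 2 ^ (n + 1)) (m / 2 ^ n)
      (by rw [div_le_div_iff₀ (by positivity) (by positivity), pow_succ]; linarith)
      (by gcongr; linarith)
      (by rw [div_le_div_iff₀ (by positivity) (by positivity), pow_succ]; linarith)
    rw [tak_fe, tak_fe (m / 2 ^ (n + 1)), tak_fe ((m + 1) / 2 ^ (n + 1)), e1, e2, e3, ha]
    rw [pow_succ _ (n + 1), ← div_div, ← ih]
    ring

lemma tak_nd (x : ℝ) : ¬ DifferentiableAt ℝ tak x := by
  intro h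
  have hd := h.hasDerivAt
  set d := deriv tak x
  rw [hasDerivAt_iff_isLittleO] at hd
  have hd := hd.def (show (0 : ℝ) < 1 / 8 by norm_num)
  rw [Metric.eventually_nhds_iff] at hd
  obtain ⟨ε, hε, hd⟩ := hd
  obtain ⟨n, hn⟩ := exists_pow_lt_of_lt_one hε (show (1 / 2 : ℝ) < 1 by norm_num)
  set δ : ℝ := 1 / 2 ^ n with hδ
  have hδ0 : 0 < δ := by positivity
  have hδε : δ < ε := by rw [hδ]; simpa using hn
  have key : ∀ y, |y - x| ≤ δ → |tak y - tak x - (y - x) * d| ≤ 1 / 8 * δ := by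
    intro y hy
    have := hd (y := y) (by rw [Real.dist_eq]; linarith)
    simp only [smul_eq_mul, Real.norm_eq_abs] at this
    linarith
  set m : ℤ := ⌊x * 2 ^ n⌋
  have f1 : (m : ℝ) ≤ x * 2 ^ n := Int.floor_le _
  have f2 : x * 2 ^ n < m + 1 := Int.lt_floor_add_one _
  have g1 : (m : ℝ) / 2 ^ n ≤ x := by rw [div_le_iff₀ (by positivity)]; exact f1
  have g2 : x ≤ ((m : ℝ) + 1) / 2 ^ n := by rw [le_div_iff₀ (by positivity)]; exact f2.le
  have g3 : ((m : ℝ) + 1) / 2 ^ n = m / 2 ^ n + δ := by rw [hδ]; ring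
  have D := tak_defect n m
  have g4 : (1 : ℝ) / 2 ^ (n + 1) = δ / 2 := by rw [hδ, pow_succ]; field_simp
  rw [g4, g3] at D
  rw [g3] at g2
  set a : ℝ := (m : ℝ) / 2 ^ n
  have k1 := abs_le.1 (key a (by rw [abs_le]; constructor <;> linarith))
  have k2 := abs_le.1 (key (a + δ) (by rw [abs_le]; constructor <;> linarith))
  have k3 := abs_le.1 (key ((a + (a + δ)) / 2) (by rw [abs_le]; constructor <;> linarith))
  have := k1.1; have := k1.2; have := k2.1; have := k2.2; have := k3.1; have := k3.2
  nlinarith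

lemma moment (k : ℝ) (hk : 0 < k) (H : ℝ → ℝ) (hH : ∀ x (n : ℕ), H (x + n * (1 / (2 * k ^ 2))) = H x)
    (n : ℕ) : ∫ x in Ioi (0 : ℝ), x ^ n * (k / √π * exp (-k ^ 2 * (log x) ^ 2) * H (log x))
      = exp (((n : ℝ) + 1) ^ 2 / (4 * k ^ 2)) * ∫ s, k / √π * exp (-k ^ 2 * s ^ 2) * H s := by
  have him : Real.exp '' univ = Ioi 0 := by rw [image_univ, Real.range_exp]
  rw [← him, integral_image_eq_integral_abs_deriv_smul (f' := Real.exp) MeasurableSet.univ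
    (fun x _ => (Real.hasDerivAt_exp x).hasDerivWithinAt) Real.exp_injective.injOn,
    setIntegral_univ, ← integral_const_mul]
  rw [← integral_add_right_eq_self _ (((n + 1 : ℕ) : ℝ) * (1 / (2 * k ^ 2)))]
  congr 1; ext s
  rw [log_exp, hH, smul_eq_mul, abs_of_pos (exp_pos _), ← exp_nat_mul]
  have : ∀ A B C D E F h : ℝ, exp A * exp B * exp C = exp D * exp E →
    exp A * (exp B * (F * exp C * h)) = exp D * (F * exp E * h) := by
    intro A B C D E F h e
    linear_combination F * h * e
  apply this
  rw [← exp_add, ← exp_add, ← exp_add]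
  congr 1
  push_cast
  field_simp
  ring

lemma gauss_int (k : ℝ) (hk : 0 < k) : Integrable fun s : ℝ => k / √π * exp (-k ^ 2 * s ^ 2) :=
  (integrable_exp_neg_mul_sq (b := k ^ 2) (by positivity)).const_mul _

lemma gauss_one (k : ℝ) (hk : 0 < k) : ∫ s : ℝ, k / √π * exp (-k ^ 2 * s ^ 2) = 1 := by
  rw [integral_const_mul, integral_gaussian, sqrt_div pi_pos.le, sqrt_sq hk.le]
  have : √π ≠ 0 := by positivity
  field_simp

theorem stmt15 (k : ℝ) (hk : 0 < k) :
    ∃ (μ ν : Measure ℝ) (fμ fν : ℝ → ℝ),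
      μ ≠ ν ∧
      μ = (volume.restrict (Ioi 0)).withDensity (fun x => ENNReal.ofReal (fμ x)) ∧
      ν = (volume.restrict (Ioi 0)).withDensity (fun x => ENNReal.ofReal (fν x)) ∧
      (∀ x ∈ Ioi (0 : ℝ), 0 ≤ fμ x) ∧ (∀ x ∈ Ioi (0 : ℝ), 0 ≤ fν x) ∧
      ContDiffOn ℝ (⊤ : ℕ∞) fμ (Ioi 0) ∧
      ContinuousOn fν (Ioi 0) ∧ (∀ x ∈ Ioi (0 : ℝ), ¬ DifferentiableAt ℝ fν x) ∧
      (∀ n : ℕ, ∫ x in Ioi (0 : ℝ), x ^ n * fμ x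
          = Real.exp (((n : ℝ) + 1) ^ 2 / (4 * k ^ 2))) ∧
      (∀ n : ℕ, ∫ x in Ioi (0 : ℝ), x ^ n * fν x
          = Real.exp (((n : ℝ) + 1) ^ 2 / (4 * k ^ 2))) := by
  set p : ℝ := 1 / (2 * k ^ 2) with hp
  have hp0 : 0 < p := by positivity
  have hc0 : 0 < k / √π := by positivity
  set W : ℝ → ℝ := fun s => 1 + tak (s / p) with hW
  have hWc : Continuous W := continuous_const.add (tak_cont.comp (by fun_prop))
  have hW1 : ∀ s, 1 ≤ W s := fun s => by have := tak_nonneg (s / p); simp only [hW]; linarith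
  have hW3 : ∀ s, W s ≤ 3 := fun s => by have := tak_le (s / p); simp only [hW]; linarith
  have hWp : ∀ x (n : ℕ), W (x + n * p) = W x := by
    intro x n
    have := tak_add_int (x / p) n
    push_cast at this
    simp only [hW]
    rw [add_div, mul_div_cancel_right₀ _ hp0.ne', this]
  set M : ℝ := ∫ s, k / √π * exp (-k ^ 2 * s ^ 2) * W s with hM
  have hM0 : 0 < M := by
    have : (1 : ℝ) ≤ M := by
      rw [← gauss_one k hk, hM]
      refine integral_mono (gauss_int k hk) ?_ ?_
      · refine (gauss_int k hk).mul_bdd (c := 3) hWc.aestronglyMeasurable ?_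
        refine Filter.Eventually.of_forall fun s => ?_
        rw [Real.norm_of_nonneg (by linarith [hW1 s])]; exact hW3 s
      · intro s
        exact le_mul_of_one_le_right (by positivity) (hW1 s)
    linarith
  set f : ℝ → ℝ := fun x => k / √π * exp (-k ^ 2 * (log x) ^ 2) with hf
  have hfd : ContDiffOn ℝ (⊤ : ℕ∞) f (Ioi 0) := by
    have hl : ContDiffOn ℝ (⊤ : ℕ∞) log (Ioi 0) :=
      Real.contDiffOn_log.mono (fun x hx => (ne_of_gt hx : x ≠ 0))
    exact contDiffOn_const.mul ((contDiffOn_const.mul (hl.pow 2)).exp)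
  set g : ℝ → ℝ := fun x => f x * (W (log x) / M) with hg
  have hgc : ContinuousOn g (Ioi 0) := by
    refine hfd.continuousOn.mul (ContinuousOn.div_const ?_ _)
    exact hWc.comp_continuousOn (continuousOn_log.mono (fun x hx => (ne_of_gt hx : x ≠ 0)))
  have hf0 : ∀ x, 0 ≤ f x := fun x => by simp only [hf]; positivity
  have hg0 : ∀ x, 0 ≤ g x := fun x =>
    mul_nonneg (hf0 x) (div_nonneg (by linarith [hW1 (log x)]) hM0.le)
  have hgn : ∀ x ∈ Ioi (0 : ℝ), ¬ DifferentiableAt ℝ g x := by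
    intro x hx hd
    have hx : 0 < x := hx
    have hE : tak = fun z => g (exp (p * z)) * M / (k / √π * exp (-k ^ 2 * (p * z) ^ 2)) - 1 := by
      ext z
      simp only [hg, hf, hW, log_exp]
      rw [mul_div_cancel_left₀ _ hp0.ne']
      have := (exp_pos (-k ^ 2 * (p * z) ^ 2)).ne'
      have : √π ≠ 0 := by positivity
      field_simp
      ring
    apply tak_nd (log x / p)
    rw [hE]
    have e : exp (p * (log x / p)) = x := by
      rw [mul_div_cancel₀ _ hp0.ne', exp_log hx]
    have h1 : DifferentiableAt ℝ (fun z => g (exp (p * z))) (log x / p) := by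
      refine DifferentiableAt.fun_comp' (g := g) (log x / p) ?_ (by fun_prop)
      rw [e]; exact hd
    refine ((h1.mul_const M).fun_div (by fun_prop) (by positivity)).sub_const 1
  refine ⟨_, _, f, g, ?_, rfl, rfl, fun x _ => hf0 x, fun x _ => hg0 x, hfd, hgc, hgn, ?_, ?_⟩
  · intro h
    have hfm : AEMeasurable f (volume.restrict (Ioi 0)) :=
      hfd.continuousOn.aemeasurable measurableSet_Ioi
    have hgm : AEMeasurable g (volume.restrict (Ioi 0)) := hgc.aemeasurable measurableSet_Ioi
    rw [withDensity_eq_iff_of_sigmaFinite hfm.ennreal_ofReal hgm.ennreal_ofReal] at h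
    have h' : f =ᵐ[volume.restrict (Ioi 0)] g := by
      filter_upwards [h] with x hx
      exact (ENNReal.ofReal_eq_ofReal_iff (hf0 x) (hg0 x)).1 hx
    have heq := Measure.eqOn_open_of_ae_eq h' isOpen_Ioi hfd.continuousOn hgc
    have h1 : (1 : ℝ) ∈ Ioi 0 := by simp
    apply hgn 1 h1
    have hd : DifferentiableAt ℝ f 1 :=
      (hfd.contDiffAt (Ioi_mem_nhds h1)).differentiableAt (by simp)
    exact hd.congr_of_eventuallyEq (heq.symm.eventuallyEq_of_mem (Ioi_mem_nhds h1))
  · intro n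
    have := moment k hk (fun _ => 1) (fun _ _ => rfl) n
    simpa only [mul_one, gauss_one k hk] using this
  · intro n
    have := moment k hk (fun s => W s / M) (fun x n => by rw [hWp]) n
    rw [this]
    simp only [← mul_div_assoc]
    rw [integral_div, ← hM, div_self hM0.ne', mul_one]
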